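/- arXiv:1810.01818 — 2 statements merged into one kernel-verified Lean document; each statement's English description precedes it below -/
import Mathlib

section
/- Let q be a prime power, n ≥ 1, and R = F_q[x₁, …, x_n]/(x₁, …, x_n)², where (x₁, …, x_n)² is the square of the ideal generated by the variables. Let R[ε] = R[ε]/(ε²) be the dual numbers over R. Define A_n(q) to be the number of orbits of the multiplication action of the unit group R[ε]× on R[ε], and B_n(q) to be the number of orbits of the action of R× on {(a, b) ∈ R × R : ab = 0} given by λ·(a, b) = (λa, λ^{-1}b). Then A_n(q) = 2 + q^n + Σ_{i=0}^{n−1} q^{i+n−1} + Σ_{i=0}^{n−1} q^i and B_n(q) = 3 + (q−1)(Σ_{i=0}^{n−1} q^i)² + 2 Σ_{i=0}^{n−1} q^i; consequently B_n(q) − A_n(q) = (q^n − 1)(q^{n−1} − 1), so A_n(q) = B_n(q) if and only if n = 1. -/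
open MvPolynomial

/-- The ring `R = F[x₁,…,x_n]/(x₁,…,x_n)²`. -/
def Rsq (F : Type) [Field F] (n : ℕ) : Type :=
  MvPolynomial (Fin n) F ⧸ (Ideal.span (Set.range (X : Fin n → MvPolynomial (Fin n) F))) ^ 2

noncomputable instance (F : Type) [Field F] (n : ℕ) : CommRing (Rsq F n) :=
  Ideal.Quotient.commRing _

/-- `A_n(q)`: the number of orbits of the unit group `R[ε]×` acting by multiplication
on the dual numbers `R[ε]` over `R = F[x₁,…,x_n]/(x₁,…,x_n)²`. -/
noncomputable def Acount (F : Type) [Field F] (n : ℕ) : ℕ :=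
  Nat.card {O : Set (DualNumber (Rsq F n)) //
    ∃ a : DualNumber (Rsq F n), O = {b | ∃ u : (DualNumber (Rsq F n))ˣ, b = u.val * a}}

/-- `B_n(q)`: the number of orbits of `R×` acting on `{(a,b) : ab = 0}` by
`λ·(a,b) = (λa, λ⁻¹b)`, for `R = F[x₁,…,x_n]/(x₁,…,x_n)²`. -/
noncomputable def Bcount (F : Type) [Field F] (n : ℕ) : ℕ :=
  Nat.card {O : Set {p : Rsq F n × Rsq F n // p.1 * p.2 = 0} //
    ∃ p₀ : {p : Rsq F n × Rsq F n // p.1 * p.2 = 0},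
      O = {p | ∃ u : (Rsq F n)ˣ,
        p.val.1 = u.val * p₀.val.1 ∧ p.val.2 = u.inv * p₀.val.2}}

open TrivSqZeroExt in
/-- The quotient ring `Rsq F n` is the trivial square-zero extension of `F` by `F ^ n`. -/
noncomputable def rsqEquiv (F : Type) [Field F] (n : ℕ) :
    Rsq F n ≃+* TrivSqZeroExt F (Fin n → F) := by
  let I : Ideal (MvPolynomial (Fin n) F) :=
    (Ideal.span (Set.range (X : Fin n → MvPolynomial (Fin n) F))) ^ 2
  have hX : ∀ i j, Ideal.Quotient.mkₐ F I (X i) * Ideal.Quotient.mkₐ F I (X j) = 0 := by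
    intro i j
    rw [← map_mul]
    refine Ideal.Quotient.eq_zero_iff_mem.2 ?_
    change _ ∈ Ideal.span (Set.range (X : Fin n → MvPolynomial (Fin n) F)) ^ 2
    rw [pow_two]
    exact Ideal.mul_mem_mul (Ideal.subset_span ⟨i, rfl⟩) (Ideal.subset_span ⟨j, rfl⟩)
  let g₀ : MvPolynomial (Fin n) F →ₐ[F] TrivSqZeroExt F (Fin n → F) :=
    aeval fun i => inr (Pi.single i 1)
  have hg₀ : ∀ p ∈ I, g₀ p = 0 := by
    have h1 : (Ideal.span (Set.range (X : Fin n → MvPolynomial (Fin n) F))).map g₀ ≤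
        RingHom.ker (fstHom F F (Fin n → F)) := by
      rw [Ideal.map_span, Ideal.span_le]
      rintro _ ⟨_, ⟨i, rfl⟩, rfl⟩
      simp [g₀, RingHom.mem_ker]
    have h2 : RingHom.ker (fstHom F F (Fin n → F)) ^ 2 = ⊥ := by
      rw [pow_two, eq_bot_iff, Ideal.mul_le]
      intro a ha b hb
      have ha' : a.fst = 0 := ha
      have hb' : b.fst = 0 := hb
      rw [Ideal.mem_bot]
      ext <;> simp [ha', hb']
    intro p hp
    have : g₀ p ∈ I.map g₀ := Ideal.mem_map_of_mem _ hp
    rw [show I = _ from rfl, Ideal.map_pow] at this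
    have h3 := Ideal.pow_right_mono h1 2 this
    rwa [h2, Ideal.mem_bot] at h3
  let g : (MvPolynomial (Fin n) F ⧸ I) →ₐ[F] TrivSqZeroExt F (Fin n → F) :=
    Ideal.Quotient.liftₐ I g₀ hg₀
  let l : (Fin n → F) →ₗ[F] (MvPolynomial (Fin n) F ⧸ I) :=
    Fintype.linearCombination F fun i => Ideal.Quotient.mkₐ F I (X i)
  have hl : ∀ x y, l x * l y = 0 := by
    intro x y
    simp only [l, Fintype.linearCombination_apply, Finset.sum_mul_sum, smul_mul_smul_comm, hX,
      smul_zero, Finset.sum_const_zero]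
  let h : TrivSqZeroExt F (Fin n → F) →ₐ[F] (MvPolynomial (Fin n) F ⧸ I) :=
    liftEquivOfComm ⟨l, hl⟩
  have hgX : ∀ i, g (Ideal.Quotient.mkₐ F I (X i)) = inr (Pi.single i 1) := by
    intro i
    change g₀ (X i) = _
    simp [g₀]
  have hh : ∀ v, h (inr v) = l v := by
    intro v
    simp [h]
  refine (AlgEquiv.ofAlgHom g h ?_ ?_).toRingEquiv
  · refine TrivSqZeroExt.algHom_ext fun v => ?_
    simp only [AlgHom.comp_apply, hh, l, Fintype.linearCombination_apply, map_sum, map_smul, hgX,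
      AlgHom.id_apply]
    ext i
    · simp [TrivSqZeroExt.fst_sum]
    · simp [Finset.sum_apply, Pi.single_apply, TrivSqZeroExt.snd_sum]
  · refine Ideal.Quotient.algHom_ext _ (MvPolynomial.algHom_ext fun i => ?_)
    simp only [AlgHom.comp_apply, hgX, hh, AlgHom.id_apply]
    simp [l, Fintype.linearCombination_apply_single]

/-- The number of classes of a partition of a finite type is the sum over the elements of the
inverse size of their class. -/
theorem card_classes_eq_sum {X Y : Type*} [Fintype Y] (j : X → Y) (hj : Function.Injective j)
    (f : X → Set X) (hmem : ∀ x, x ∈ f x) (heq : ∀ x, ∀ y ∈ f x, f y = f x) (k : Y → ℚ)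
    (hk₀ : ∀ y, y ∉ Set.range j → k y = 0) (hk : ∀ x, k (j x) = ((j '' f x).ncard : ℚ)⁻¹) :
    (Nat.card {O : Set X // ∃ a, O = f a} : ℚ) = ∑ y, k y := by
  classical
  have : Finite X := Finite.of_injective j hj
  have := Fintype.ofFinite X
  have hset : {O : Set X | ∃ a, O = f a} = ↑(Finset.univ.image f) := by
    ext O
    simp [eq_comm]
  have hcard : Nat.card {O : Set X // ∃ a, O = f a} = (Finset.univ.image f).card := by
    rw [← Set.ncard_coe_finset, ← hset]
    rfl
  have hsum : ∑ y, k y = ∑ x, ((f x).ncard : ℚ)⁻¹ := by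
    rw [← Finset.sum_subset (Finset.subset_univ (Finset.univ.image j)),
      Finset.sum_image hj.injOn]
    · refine Finset.sum_congr rfl fun x _ => ?_
      rw [hk, Set.ncard_image_of_injective _ hj]
    · intro y _ hy
      exact hk₀ y fun ⟨x, hx⟩ => hy (Finset.mem_image.2 ⟨x, Finset.mem_univ _, hx⟩)
  rw [hcard, hsum, ← Finset.sum_fiberwise_of_maps_to (s := Finset.univ) (g := f)
    (t := Finset.univ.image f) (fun x _ => Finset.mem_image_of_mem _ (Finset.mem_univ x)),
    Finset.card_eq_sum_ones, Nat.cast_sum]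
  refine Finset.sum_congr rfl fun O hO => ?_
  obtain ⟨a, -, rfl⟩ := Finset.mem_image.1 hO
  have hfib : ((Finset.univ.filter fun x => f x = f a : Finset X) : Set X) = f a := by
    ext x
    simp only [Finset.coe_filter, Finset.mem_univ, true_and, Set.mem_ofPred_eq]
    exact ⟨fun h => h ▸ hmem x, fun h => heq a x h⟩
  have hne : ((f a).ncard : ℚ) ≠ 0 :=
    Nat.cast_ne_zero.2 ((Set.ncard_pos (Set.toFinite _)).2 ⟨a, hmem a⟩).ne'
  rw [Finset.sum_congr rfl (g := fun _ => ((f a).ncard : ℚ)⁻¹)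
    (fun x hx => by rw [(Finset.mem_filter.1 hx).2]), Finset.sum_const, nsmul_eq_mul,
    ← Set.ncard_coe_finset, hfib, mul_inv_cancel₀ hne, Nat.cast_one]

theorem ncard_of_eq_range {T Y : Type*} {s : Set Y} (r : T → Y) (hr : Function.Injective r)
    (hs : s = Set.range r) : s.ncard = Nat.card T := by
  rw [hs]
  exact Nat.card_range_of_injective hr

theorem sum_ite_eq_zero_const {α : Type*} [Fintype α] [Zero α] [DecidableEq α] (s t : ℚ) :
    ∑ x : α, (if x = 0 then s else t) = s + (Fintype.card α - 1) * t := by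
  rw [← Finset.add_sum_erase _ _ (Finset.mem_univ (0 : α)), if_pos rfl,
    Finset.sum_congr rfl (g := fun _ => t) (fun x hx => if_neg (Finset.ne_of_mem_erase hx)),
    Finset.sum_const, Finset.card_erase_of_mem (Finset.mem_univ _), nsmul_eq_mul,
    Finset.card_univ, Nat.cast_sub (Fintype.card_pos_iff.2 ⟨0⟩), Nat.cast_one]

section Orbits

variable {F : Type} [Field F] {V : Type} [AddCommGroup V] [Module F V]

/-- The orbit of `a + v + (b + w) ε` under multiplication by the units of the dual numbers over
the trivial square-zero extension of `F` by `V`. -/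
def dualOrbit (a : F) (v : V) (b : F) (w : V) : Set ((F × V) × F × V) :=
  {y | ∃ (s : F) (p : V) (c : F) (d : V), s ≠ 0 ∧
    y = ((s * a, s • v + a • p), (s * b + c * a, s • w + b • p + (c • v + a • d)))}

/-- The orbit of the pair `(a + v, b + w)` under the hyperbolic action of the units of the trivial
square-zero extension of `F` by `V`. -/
def hyperbolicOrbit (a : F) (v : V) (b : F) (w : V) : Set ((F × V) × F × V) :=
  {y | ∃ (s : F) (p : V), s ≠ 0 ∧
    y = ((s * a, s • v + a • p), (s⁻¹ * b, s⁻¹ • w - (b * s⁻¹ * s⁻¹) • p))}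

theorem natCard_units_eq [Fintype F] : Nat.card Fˣ = Fintype.card F - 1 := by
  classical
  rw [Nat.card_eq_fintype_card, Fintype.card_units]

theorem ncard_dualOrbit_of_ne [Fintype F] [Fintype V] {a : F} (ha : a ≠ 0) (v : V) (b : F) (w : V) :
    (dualOrbit a v b w).ncard =
      (Fintype.card F - 1) * (Fintype.card V * (Fintype.card F * Fintype.card V)) := by
  rw [ncard_of_eq_range (T := Fˣ × V × F × V)
    (fun t => ((t.1.val, t.2.1), (t.2.2.1, t.2.2.2)))]
  · simp [natCard_units_eq, Nat.card_prod]
  · rintro ⟨t, z, c, d⟩ ⟨t', z', c', d'⟩ h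
    simp only [Prod.mk.injEq] at h ⊢
    exact ⟨Units.ext h.1.1, h.1.2, h.2⟩
  · ext ⟨⟨t, z⟩, ⟨c, d⟩⟩
    simp only [dualOrbit, Set.mem_ofPred_eq, Set.mem_range, Prod.mk.injEq, Prod.exists]
    constructor
    · rintro ⟨s, p, c, d, hs, ⟨rfl, rfl⟩, rfl, rfl⟩
      exact ⟨Units.mk0 (s * a) (mul_ne_zero hs ha), _, _, _, ⟨rfl, rfl⟩, rfl, rfl⟩
    · rintro ⟨t, z, c, d, ⟨rfl, rfl⟩, rfl, rfl⟩
      refine ⟨t * a⁻¹, a⁻¹ • (z - (t * a⁻¹ : F) • v), (c - t * a⁻¹ * b) * a⁻¹,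
        a⁻¹ • (d - (t * a⁻¹ : F) • w - b • a⁻¹ • (z - (t * a⁻¹ : F) • v)
          - ((c - t * a⁻¹ * b) * a⁻¹) • v), by simp [ha], ⟨?_, ?_⟩, ?_, ?_⟩
      · field_simp
      · rw [smul_inv_smul₀ ha]; abel
      · field_simp; ring
      · rw [smul_inv_smul₀ ha]; abel

theorem ncard_dualOrbit_zero_of_ne [Fintype F] [Fintype V] (v : V) {b : F} (hb : b ≠ 0) (w : V) :
    (dualOrbit 0 v b w).ncard = (Fintype.card F - 1) * Fintype.card V := by
  rw [ncard_of_eq_range (T := Fˣ × V)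
    (fun t => ((0, t.1.val • v), (t.1.val * b, t.2)))]
  · simp [natCard_units_eq, Nat.card_prod]
  · rintro ⟨t, z⟩ ⟨t', z'⟩ h
    simp only [Prod.mk.injEq] at h ⊢
    exact ⟨Units.ext (mul_right_cancel₀ hb h.2.1), h.2.2⟩
  · ext ⟨⟨t, z⟩, ⟨c, d⟩⟩
    simp only [dualOrbit, Set.mem_ofPred_eq, Set.mem_range, Prod.mk.injEq, Prod.exists]
    constructor
    · rintro ⟨s, p, c, d, hs, ⟨rfl, rfl⟩, rfl, rfl⟩
      exact ⟨Units.mk0 s hs, _, ⟨by simp, by simp⟩, by simp, rfl⟩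
    · rintro ⟨t, d, ⟨rfl, rfl⟩, rfl, rfl⟩
      refine ⟨t, b⁻¹ • (d - (t : F) • w), 0, 0, t.ne_zero, ⟨by simp, by simp⟩, by simp, ?_⟩
      rw [smul_inv_smul₀ hb]
      simp

theorem ncard_dualOrbit_zero_zero_of_ne [Fintype F] {v : V} (hv : v ≠ 0) (w : V) :
    (dualOrbit (0 : F) v 0 w).ncard = (Fintype.card F - 1) * Fintype.card F := by
  rw [ncard_of_eq_range (T := Fˣ × F)
    (fun t => ((0, t.1.val • v), (0, t.1.val • w + t.2 • v)))]
  · simp [natCard_units_eq, Nat.card_prod]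
  · rintro ⟨t, z⟩ ⟨t', z'⟩ h
    simp only [Prod.mk.injEq] at h ⊢
    obtain ⟨⟨-, h1⟩, -, h2⟩ := h
    have h3 : t = t' := Units.ext (smul_left_injective F hv h1)
    subst h3
    exact ⟨rfl, smul_left_injective F hv (add_left_cancel h2)⟩
  · ext ⟨⟨t, z⟩, ⟨c, d⟩⟩
    simp only [dualOrbit, Set.mem_ofPred_eq, Set.mem_range, Prod.mk.injEq, Prod.exists]
    constructor
    · rintro ⟨s, p, c, d, hs, ⟨rfl, rfl⟩, rfl, rfl⟩
      exact ⟨Units.mk0 s hs, c, ⟨by simp, by simp⟩, by simp, by simp⟩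
    · rintro ⟨t, c, ⟨rfl, rfl⟩, rfl, rfl⟩
      exact ⟨t, 0, c, 0, t.ne_zero, ⟨by simp, by simp⟩, by simp, by simp⟩

theorem ncard_dualOrbit_zero_zero_zero_of_ne [Fintype F] {w : V} (hw : w ≠ 0) :
    (dualOrbit (0 : F) 0 0 w).ncard = Fintype.card F - 1 := by
  rw [ncard_of_eq_range (T := Fˣ) (fun t => ((0, 0), (0, t.val • w)))]
  · exact natCard_units_eq
  · intro t t' h
    simp only [Prod.mk.injEq] at h
    exact Units.ext (smul_left_injective F hw h.2.2)
  · ext ⟨⟨t, z⟩, ⟨c, d⟩⟩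
    simp only [dualOrbit, Set.mem_ofPred_eq, Set.mem_range, Prod.mk.injEq]
    constructor
    · rintro ⟨s, p, c, d, hs, ⟨rfl, rfl⟩, rfl, rfl⟩
      exact ⟨Units.mk0 s hs, ⟨by simp, by simp⟩, by simp, by simp⟩
    · rintro ⟨t, ⟨rfl, rfl⟩, rfl, rfl⟩
      exact ⟨t, 0, 0, 0, t.ne_zero, ⟨by simp, by simp⟩, by simp, by simp⟩

theorem ncard_dualOrbit_zero : (dualOrbit (0 : F) (0 : V) 0 0).ncard = 1 := by
  rw [Set.ncard_eq_one]
  refine ⟨0, ?_⟩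
  ext y
  simp only [dualOrbit, Set.mem_ofPred_eq, Set.mem_singleton_iff]
  constructor
  · rintro ⟨s, p, c, d, hs, rfl⟩
    simp
  · rintro rfl
    exact ⟨1, 0, 0, 0, one_ne_zero, by simp; rfl⟩

theorem ncard_hyperbolicOrbit_left [Fintype F] [Fintype V] {a : F} (ha : a ≠ 0) (v : V) :
    (hyperbolicOrbit a v 0 0).ncard = (Fintype.card F - 1) * Fintype.card V := by
  rw [ncard_of_eq_range (T := Fˣ × V) (fun t => ((t.1.val, t.2), (0, 0)))]
  · simp [natCard_units_eq, Nat.card_prod]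
  · rintro ⟨t, z⟩ ⟨t', z'⟩ h
    simp only [Prod.mk.injEq] at h ⊢
    exact ⟨Units.ext h.1.1, h.1.2⟩
  · ext ⟨⟨t, z⟩, ⟨c, d⟩⟩
    simp only [hyperbolicOrbit, Set.mem_ofPred_eq, Set.mem_range, Prod.mk.injEq, Prod.exists]
    constructor
    · rintro ⟨s, p, hs, ⟨rfl, rfl⟩, rfl, rfl⟩
      exact ⟨Units.mk0 (s * a) (mul_ne_zero hs ha), _, ⟨rfl, rfl⟩, by simp, by simp⟩
    · rintro ⟨t, z, ⟨rfl, rfl⟩, rfl, rfl⟩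
      refine ⟨t * a⁻¹, a⁻¹ • (z - (t * a⁻¹ : F) • v), by simp [ha], ⟨?_, ?_⟩, by simp, by simp⟩
      · field_simp
      · rw [smul_inv_smul₀ ha]; abel

theorem ncard_hyperbolicOrbit_right [Fintype F] [Fintype V] {b : F} (hb : b ≠ 0) (w : V) :
    (hyperbolicOrbit 0 0 b w).ncard = (Fintype.card F - 1) * Fintype.card V := by
  rw [ncard_of_eq_range (T := Fˣ × V) (fun t => ((0, 0), (t.1.val, t.2)))]
  · simp [natCard_units_eq, Nat.card_prod]
  · rintro ⟨t, z⟩ ⟨t', z'⟩ h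
    simp only [Prod.mk.injEq] at h ⊢
    exact ⟨Units.ext h.2.1, h.2.2⟩
  · ext ⟨⟨t, z⟩, ⟨c, d⟩⟩
    simp only [hyperbolicOrbit, Set.mem_ofPred_eq, Set.mem_range, Prod.mk.injEq, Prod.exists]
    constructor
    · rintro ⟨s, p, hs, ⟨rfl, rfl⟩, rfl, rfl⟩
      exact ⟨Units.mk0 (s⁻¹ * b) (mul_ne_zero (inv_ne_zero hs) hb), _, ⟨by simp, by simp⟩, rfl, rfl⟩
    · rintro ⟨t, z, ⟨rfl, rfl⟩, rfl, rfl⟩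
      have ht : (t : F) ≠ 0 := t.ne_zero
      set s : F := b * (t : F)⁻¹ with hs
      have hs0 : s ≠ 0 := mul_ne_zero hb (inv_ne_zero ht)
      have h0 : b * s⁻¹ * s⁻¹ ≠ 0 := mul_ne_zero (mul_ne_zero hb (inv_ne_zero hs0)) (inv_ne_zero hs0)
      refine ⟨s, (b * s⁻¹ * s⁻¹)⁻¹ • (s⁻¹ • w - z), hs0, ⟨by simp, by simp⟩, ?_, ?_⟩
      · rw [hs]; field_simp
      · rw [smul_inv_smul₀ h0]; abel

theorem ncard_hyperbolicOrbit_zero_zero [Fintype F] {v w : V} (h : v ≠ 0 ∨ w ≠ 0) :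
    (hyperbolicOrbit (0 : F) v 0 w).ncard = Fintype.card F - 1 := by
  rw [ncard_of_eq_range (T := Fˣ) (fun t => ((0, t.val • v), (0, t.val⁻¹ • w)))]
  · exact natCard_units_eq
  · intro t t' ht
    simp only [Prod.mk.injEq] at ht
    rcases h with h | h
    · exact Units.ext (smul_left_injective F h ht.1.2)
    · exact Units.ext (inv_injective (smul_left_injective F h ht.2.2))
  · ext ⟨⟨t, z⟩, ⟨c, d⟩⟩
    simp only [hyperbolicOrbit, Set.mem_ofPred_eq, Set.mem_range, Prod.mk.injEq]
    constructor
    · rintro ⟨s, p, hs, ⟨rfl, rfl⟩, rfl, rfl⟩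
      exact ⟨Units.mk0 s hs, ⟨by simp, by simp⟩, by simp, by simp⟩
    · rintro ⟨t, ⟨rfl, rfl⟩, rfl, rfl⟩
      exact ⟨t, 0, t.ne_zero, ⟨by simp, by simp⟩, by simp, by simp⟩

theorem ncard_hyperbolicOrbit_zero : (hyperbolicOrbit (0 : F) (0 : V) 0 0).ncard = 1 := by
  rw [Set.ncard_eq_one]
  refine ⟨0, ?_⟩
  ext y
  simp only [hyperbolicOrbit, Set.mem_ofPred_eq, Set.mem_singleton_iff]
  constructor
  · rintro ⟨s, p, hs, rfl⟩
    simp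
  · rintro rfl
    exact ⟨1, 0, one_ne_zero, by simp; rfl⟩

end Orbits

open TrivSqZeroExt in
/-- The coordinates of an element of the dual numbers over `Rsq F n`. -/
noncomputable def dualCoord (F : Type) [Field F] (n : ℕ) (x : DualNumber (Rsq F n)) :
    (F × (Fin n → F)) × F × (Fin n → F) :=
  (((rsqEquiv F n x.fst).fst, (rsqEquiv F n x.fst).snd),
    ((rsqEquiv F n x.snd).fst, (rsqEquiv F n x.snd).snd))

/-- The coordinates of a pair of elements of `Rsq F n` with product zero. -/
noncomputable def pairCoord (F : Type) [Field F] (n : ℕ)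
    (x : {p : Rsq F n × Rsq F n // p.1 * p.2 = 0}) :
    (F × (Fin n → F)) × F × (Fin n → F) :=
  (((rsqEquiv F n x.val.1).fst, (rsqEquiv F n x.val.1).snd),
    ((rsqEquiv F n x.val.2).fst, (rsqEquiv F n x.val.2).snd))

section Coordinates

variable {F : Type} [Field F] {n : ℕ}

theorem isUnit_dualNumber_iff {S : Type*} [CommRing S] (u : DualNumber S) :
    IsUnit u ↔ IsUnit (TrivSqZeroExt.fst u) :=
  TrivSqZeroExt.isUnit_iff_isUnit_fst

theorem isUnit_rsq_iff (x : Rsq F n) : IsUnit x ↔ (rsqEquiv F n x).fst ≠ 0 := by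
  rw [← MulEquiv.isUnit_map (rsqEquiv F n), TrivSqZeroExt.isUnit_iff_isUnit_fst, isUnit_iff_ne_zero]

theorem dualCoord_injective : Function.Injective (dualCoord F n) := by
  intro x y h
  simp only [dualCoord, Prod.mk.injEq] at h
  exact TrivSqZeroExt.ext ((rsqEquiv F n).injective (TrivSqZeroExt.ext h.1.1 h.1.2))
    ((rsqEquiv F n).injective (TrivSqZeroExt.ext h.2.1 h.2.2))

theorem dualCoord_surjective : Function.Surjective (dualCoord F n) := by
  rintro ⟨⟨a, v⟩, ⟨b, w⟩⟩
  refine ⟨TrivSqZeroExt.inl ((rsqEquiv F n).symm (TrivSqZeroExt.inl a + TrivSqZeroExt.inr v)) +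
    TrivSqZeroExt.inr ((rsqEquiv F n).symm (TrivSqZeroExt.inl b + TrivSqZeroExt.inr w)), ?_⟩
  simp [dualCoord]

theorem pairCoord_injective : Function.Injective (pairCoord F n) := by
  intro x y h
  simp only [pairCoord, Prod.mk.injEq] at h
  exact Subtype.ext (Prod.ext ((rsqEquiv F n).injective (TrivSqZeroExt.ext h.1.1 h.1.2))
    ((rsqEquiv F n).injective (TrivSqZeroExt.ext h.2.1 h.2.2)))

theorem dualCoord_mul (u x : DualNumber (Rsq F n)) (s a c b : F) (p v d w : Fin n → F)
    (hu : dualCoord F n u = ((s, p), (c, d))) (hx : dualCoord F n x = ((a, v), (b, w))) :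
    dualCoord F n (u * x) =
      ((s * a, s • v + a • p), (s * b + c * a, s • w + b • p + (c • v + a • d))) := by
  simp only [dualCoord, Prod.mk.injEq] at hu hx
  obtain ⟨⟨rfl, rfl⟩, rfl, rfl⟩ := hu
  obtain ⟨⟨rfl, rfl⟩, rfl, rfl⟩ := hx
  simp only [dualCoord, TrivSqZeroExt.fst_mul, TrivSqZeroExt.snd_mul, map_mul, map_add,
    smul_eq_mul, op_smul_eq_smul, TrivSqZeroExt.fst_add, TrivSqZeroExt.snd_add]
  refine Prod.ext rfl (Prod.ext ?_ ?_)
  · ring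
  · dsimp only
    abel

theorem image_dualCoord_orbit (x : DualNumber (Rsq F n)) (a b : F) (v w : Fin n → F)
    (hx : dualCoord F n x = ((a, v), (b, w))) :
    dualCoord F n '' {y | ∃ u : (DualNumber (Rsq F n))ˣ, y = u.val * x} = dualOrbit a v b w := by
  have hunit : ∀ u : DualNumber (Rsq F n), IsUnit u ↔ (dualCoord F n u).1.1 ≠ 0 := fun u => by
    exact (isUnit_dualNumber_iff u).trans (isUnit_rsq_iff _)
  ext y
  constructor
  · rintro ⟨_, ⟨u, rfl⟩, rfl⟩
    exact ⟨_, _, _, _, (hunit _).1 u.isUnit, dualCoord_mul _ _ _ _ _ _ _ _ _ _ rfl hx⟩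
  · rintro ⟨s, p, c, d, hs, rfl⟩
    obtain ⟨u, hu⟩ := dualCoord_surjective ((s, p), (c, d))
    have h : IsUnit u := (hunit u).2 (by rw [hu]; exact hs)
    exact ⟨u * x, ⟨h.unit, rfl⟩, dualCoord_mul _ _ _ _ _ _ _ _ _ _ hu hx⟩

theorem mem_range_pairCoord (a b : F) (v w : Fin n → F) :
    ((a, v), (b, w)) ∈ Set.range (pairCoord F n) ↔ a * b = 0 ∧ a • w + b • v = 0 := by
  constructor
  · rintro ⟨⟨⟨x, y⟩, hxy⟩, h⟩
    simp only [pairCoord, Prod.mk.injEq] at h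
    obtain ⟨⟨rfl, rfl⟩, rfl, rfl⟩ := h
    have h := congrArg (rsqEquiv F n) hxy
    rw [map_mul, map_zero] at h
    exact ⟨by simpa using congrArg TrivSqZeroExt.fst h,
      by simpa using congrArg TrivSqZeroExt.snd h⟩
  · rintro ⟨h1, h2⟩
    refine ⟨⟨((rsqEquiv F n).symm (TrivSqZeroExt.inl a + TrivSqZeroExt.inr v),
      (rsqEquiv F n).symm (TrivSqZeroExt.inl b + TrivSqZeroExt.inr w)), ?_⟩, ?_⟩
    · apply (rsqEquiv F n).injective
      ext1 <;> simp [h1, h2]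
    · simp [pairCoord]

theorem rsqEquiv_inv (u : (Rsq F n)ˣ) :
    (rsqEquiv F n u.inv).fst = (rsqEquiv F n u.val).fst⁻¹ ∧
    (rsqEquiv F n u.inv).snd =
      -((rsqEquiv F n u.val).fst⁻¹ * (rsqEquiv F n u.val).fst⁻¹) • (rsqEquiv F n u.val).snd := by
  have hs := (isUnit_rsq_iff u.val).1 u.isUnit
  have h := congrArg (rsqEquiv F n) u.val_inv
  rw [map_mul, map_one] at h
  have h1 : (rsqEquiv F n u.val).fst * (rsqEquiv F n u.inv).fst = 1 := by
    simpa using congrArg TrivSqZeroExt.fst h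
  have h2 : (rsqEquiv F n u.val).fst • (rsqEquiv F n u.inv).snd +
      (rsqEquiv F n u.inv).fst • (rsqEquiv F n u.val).snd = 0 := by
    simpa using congrArg TrivSqZeroExt.snd h
  have h3 := eq_inv_of_mul_eq_one_right h1
  refine ⟨h3, smul_right_injective _ hs ?_⟩
  rw [h3] at h2
  dsimp only
  rw [eq_neg_of_add_eq_zero_left h2, smul_smul, ← neg_smul]
  congr 1
  field_simp

theorem image_pairCoord_orbit (x : {p : Rsq F n × Rsq F n // p.1 * p.2 = 0}) (a b : F)
    (v w : Fin n → F) (hx : pairCoord F n x = ((a, v), (b, w))) :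
    pairCoord F n '' {p | ∃ u : (Rsq F n)ˣ,
      p.val.1 = u.val * x.val.1 ∧ p.val.2 = u.inv * x.val.2} = hyperbolicOrbit a v b w := by
  simp only [pairCoord, Prod.mk.injEq] at hx
  obtain ⟨⟨rfl, rfl⟩, rfl, rfl⟩ := hx
  have hcoord : ∀ (y : {p : Rsq F n × Rsq F n // p.1 * p.2 = 0}) (u : (Rsq F n)ˣ),
      y.val.1 = u.val * x.val.1 → y.val.2 = u.inv * x.val.2 → ∀ s p,
      (rsqEquiv F n u.val).fst = s → (rsqEquiv F n u.val).snd = p → pairCoord F n y =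
        ((s * (rsqEquiv F n x.val.1).fst,
          s • (rsqEquiv F n x.val.1).snd + (rsqEquiv F n x.val.1).fst • p),
        (s⁻¹ * (rsqEquiv F n x.val.2).fst, s⁻¹ • (rsqEquiv F n x.val.2).snd -
          ((rsqEquiv F n x.val.2).fst * s⁻¹ * s⁻¹) • p)) := by
    rintro y u h1 h2 s p rfl rfl
    obtain ⟨h3, h4⟩ := rsqEquiv_inv u
    simp only [pairCoord, h1, h2, map_mul, TrivSqZeroExt.fst_mul, TrivSqZeroExt.snd_mul,
      op_smul_eq_smul, h3, h4, smul_smul, neg_smul, smul_neg, sub_eq_add_neg, mul_assoc]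
  ext y
  constructor
  · rintro ⟨y, ⟨u, h1, h2⟩, rfl⟩
    exact ⟨_, _, (isUnit_rsq_iff _).1 u.isUnit, hcoord y u h1 h2 _ _ rfl rfl⟩
  · rintro ⟨s, p, hs, rfl⟩
    have hu : rsqEquiv F n ((rsqEquiv F n).symm (TrivSqZeroExt.inl s + TrivSqZeroExt.inr p)) =
      TrivSqZeroExt.inl s + TrivSqZeroExt.inr p := (rsqEquiv F n).apply_symm_apply _
    have h : IsUnit ((rsqEquiv F n).symm (TrivSqZeroExt.inl s + TrivSqZeroExt.inr p)) :=
      (isUnit_rsq_iff _).2 (by rw [hu]; simpa using hs)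
    refine ⟨⟨(h.unit.val * x.val.1, h.unit.inv * x.val.2), ?_⟩, ⟨h.unit, rfl, rfl⟩,
      hcoord _ h.unit rfl rfl s p ?_ ?_⟩
    · dsimp only
      rw [mul_mul_mul_comm, h.unit.val_inv, x.2, mul_zero]
    · rw [IsUnit.unit_spec, hu]; simp
    · rw [IsUnit.unit_spec, hu]; simp


theorem acount_eq (F : Type) [Field F] [Fintype F] (n : ℕ) (q Q : ℚ) (hq : q = Fintype.card F)
    (hQ : Q = q ^ n) :
    (Acount F n : ℚ) = 2 + Q + (Q - 1) / (q - 1) * (Q / q) + (Q - 1) / (q - 1) := by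
  classical
  have hq2 : (2 : ℚ) ≤ q := by rw [hq]; exact_mod_cast Fintype.one_lt_card (α := F)
  have hq1 : ((Fintype.card F - 1 : ℕ) : ℚ) = q - 1 := by
    rw [Nat.cast_sub Fintype.card_pos, hq, Nat.cast_one]
  have hV : (Fintype.card (Fin n → F) : ℚ) = Q := by simp [hQ, hq]
  unfold Acount
  rw [card_classes_eq_sum (dualCoord F n) dualCoord_injective
    (fun a => {b | ∃ u : (DualNumber (Rsq F n))ˣ, b = u.val * a})
    (fun x => ⟨1, by simp⟩) ?_
    (fun y => if y.1.1 = 0 then if y.2.1 = 0 then if y.1.2 = 0 then if y.2.2 = 0 then 1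
      else (q - 1)⁻¹ else ((q - 1) * q)⁻¹ else ((q - 1) * Q)⁻¹ else ((q - 1) * (Q * (q * Q)))⁻¹)
    (fun y hy => absurd (dualCoord_surjective y) hy)]
  · simp only [Fintype.sum_prod_type, Finset.sum_ite_irrel, Finset.sum_const, Finset.card_univ,
      sum_ite_eq_zero_const, nsmul_eq_mul, Fintype.card_prod,
      Finset.sum_add_distrib, Nat.cast_mul, hV, ← hq]
    have : q - 1 ≠ 0 := by linarith
    have : q ≠ 0 := by linarith
    have : Q ≠ 0 := by rw [hQ]; positivity
    field_simp
    ring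
  · intro x
    obtain ⟨a, v, b, w, hx⟩ : ∃ a v b w, dualCoord F n x = ((a, v), (b, w)) := ⟨_, _, _, _, rfl⟩
    rw [image_dualCoord_orbit x a b v w hx, hx]
    dsimp only
    split_ifs with h1 h2 h3 h4
    · rw [h1, h2, h3, h4, ncard_dualOrbit_zero]; simp
    · rw [h1, h2, h3, ncard_dualOrbit_zero_zero_zero_of_ne h4, hq1]
    · rw [h1, h2, ncard_dualOrbit_zero_zero_of_ne h3, Nat.cast_mul, hq1, hq]
    · rw [h1, ncard_dualOrbit_zero_of_ne _ h2, Nat.cast_mul, hq1, hV]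
    · rw [ncard_dualOrbit_of_ne h1, Nat.cast_mul, Nat.cast_mul, Nat.cast_mul, hq1, hV, hq]
  · rintro x _ ⟨u, rfl⟩
    ext z
    constructor
    · rintro ⟨t, rfl⟩
      exact ⟨t * u, by simp [mul_assoc]⟩
    · rintro ⟨t, rfl⟩
      exact ⟨t * u⁻¹, by simp [mul_assoc]⟩

theorem bcount_eq (F : Type) [Field F] [Fintype F] (n : ℕ) (q Q : ℚ) (hq : q = Fintype.card F)
    (hQ : Q = q ^ n) :
    (Bcount F n : ℚ) = 3 + (q - 1) * ((Q - 1) / (q - 1)) ^ 2 + 2 * ((Q - 1) / (q - 1)) := by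
  classical
  have hq2 : (2 : ℚ) ≤ q := by rw [hq]; exact_mod_cast Fintype.one_lt_card (α := F)
  have hq1 : ((Fintype.card F - 1 : ℕ) : ℚ) = q - 1 := by
    rw [Nat.cast_sub Fintype.card_pos, hq, Nat.cast_one]
  have hV : (Fintype.card (Fin n → F) : ℚ) = Q := by simp [hQ, hq]
  unfold Bcount
  rw [card_classes_eq_sum (pairCoord F n) pairCoord_injective
    (fun p₀ => {p | ∃ u : (Rsq F n)ˣ,
        p.val.1 = u.val * p₀.val.1 ∧ p.val.2 = u.inv * p₀.val.2})
    (fun x => ⟨1, by simp [Units.inv_eq_val_inv]⟩) ?_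
    (fun y => if y.1.1 = 0 then
        if y.1.2 = 0 then
          if y.2.1 = 0 then if y.2.2 = 0 then 1 else (q - 1)⁻¹ else ((q - 1) * Q)⁻¹
        else if y.2.1 = 0 then (q - 1)⁻¹ else 0
      else if y.2.1 = 0 then if y.2.2 = 0 then ((q - 1) * Q)⁻¹ else 0 else 0)]
  · rw [Fintype.sum_prod_type, Finset.sum_congr rfl (g := fun x : F × (Fin n → F) =>
      if x.1 = 0 then
        if x.2 = 0 then 1 + (Q - 1) * (q - 1)⁻¹ + (q - 1) * (Q * ((q - 1) * Q)⁻¹)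
        else Q * (q - 1)⁻¹
      else ((q - 1) * Q)⁻¹)]
    swap
    · intro x _
      rw [Fintype.sum_prod_type]
      split_ifs
      · simp only [Finset.sum_ite_irrel, Finset.sum_const, Finset.card_univ,
          sum_ite_eq_zero_const, nsmul_eq_mul, hV]
        rw [← hq]
      · rw [Finset.sum_comm]
        simp only [Finset.sum_const, Finset.card_univ, sum_ite_eq_zero_const, nsmul_eq_mul, hV,
          mul_zero, add_zero]
      · simp only [Finset.sum_ite_irrel, Finset.sum_const, Finset.card_univ,
          sum_ite_eq_zero_const, mul_zero, smul_zero, add_zero]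
    simp only [Fintype.sum_prod_type, Finset.sum_ite_irrel, Finset.sum_const, Finset.card_univ,
      sum_ite_eq_zero_const, nsmul_eq_mul, hV, ← hq]
    have : q - 1 ≠ 0 := by linarith
    have : q ≠ 0 := by linarith
    have : Q ≠ 0 := by rw [hQ]; positivity
    field_simp
    ring
  · rintro ⟨⟨a, v⟩, ⟨b, w⟩⟩ hy
    rw [mem_range_pairCoord] at hy
    dsimp only
    split_ifs with h1 h2 h3 h4 h5 h6 h7 <;> first | rfl | (exfalso; apply hy; simp [*])
  · intro x
    obtain ⟨a, v, b, w, hx⟩ : ∃ a v b w, pairCoord F n x = ((a, v), (b, w)) := ⟨_, _, _, _, rfl⟩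
    obtain ⟨h1, h2⟩ := (mem_range_pairCoord a b v w).1 ⟨x, hx⟩
    rw [image_pairCoord_orbit x a b v w hx, hx]
    dsimp only
    by_cases ha : a = 0
    · subst ha
      by_cases hb : b = 0
      · subst hb
        by_cases hv : v = 0
        · by_cases hw : w = 0
          · simp [hv, hw, ncard_hyperbolicOrbit_zero]
          · simp [hv, hw, ncard_hyperbolicOrbit_zero_zero (F := F) (Or.inr hw), hq1]
        · simp [hv, ncard_hyperbolicOrbit_zero_zero (F := F) (Or.inl hv), hq1]
      · have hv : v = 0 := by simpa [hb] using h2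
        subst hv
        rw [ncard_hyperbolicOrbit_right hb, Nat.cast_mul, hq1, hV]
        simp [hb]
    · have hb : b = 0 := by simpa [ha] using h1
      subst hb
      have hw : w = 0 := by simpa [ha] using h2
      subst hw
      rw [ncard_hyperbolicOrbit_left ha, Nat.cast_mul, hq1, hV]
      simp [ha]
  · rintro x y ⟨u, h1, h2⟩
    ext z
    simp only [Units.inv_eq_val_inv] at h2 ⊢
    constructor
    · rintro ⟨t, h3, h4⟩
      exact ⟨t * u, by rw [h3, h1]; simp [mul_assoc], by rw [h4, h2]; simp; ring⟩
    · rintro ⟨t, h3, h4⟩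
      refine ⟨t * u⁻¹, by rw [h3, h1]; simp [mul_assoc], ?_⟩
      rw [h4, h2, mul_inv_rev, inv_inv, Units.val_mul, mul_comm u.val, mul_assoc,
        Units.mul_inv_cancel_left]

end Coordinates

/-- A counterexample over the non-Frobenius algebra `R = F_q[x₁,…,x_n]/(x₁,…,x_n)²` for
`n > 1`: explicit formulas for `A_n(q)` and `B_n(q)`, the difference
`B_n(q) − A_n(q) = (q^n − 1)(q^{n−1} − 1)`, and `A_n(q) = B_n(q)` iff `n = 1`. -/
theorem counterexample_non_frobenius_orbit_counts
    (F : Type) [Field F] [Fintype F] (n : ℕ) (hn : 1 ≤ n) :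
    Acount F n = 2 + Fintype.card F ^ n +
        (∑ i ∈ Finset.range n, Fintype.card F ^ (i + n - 1)) +
        ∑ i ∈ Finset.range n, Fintype.card F ^ i ∧
    Bcount F n = 3 + (Fintype.card F - 1) * (∑ i ∈ Finset.range n, Fintype.card F ^ i) ^ 2 +
        2 * ∑ i ∈ Finset.range n, Fintype.card F ^ i ∧
    Bcount F n = Acount F n + (Fintype.card F ^ n - 1) * (Fintype.card F ^ (n - 1) - 1) ∧
    (Acount F n = Bcount F n ↔ n = 1) := by
  obtain ⟨m, rfl⟩ := Nat.exists_eq_add_of_le' hn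
  have hcard : 1 < Fintype.card F := Fintype.one_lt_card
  have hA := acount_eq F (m + 1) _ _ rfl rfl
  have hB := bcount_eq F (m + 1) _ _ rfl rfl
  generalize Fintype.card F = q at *
  have hq1 : (q : ℚ) - 1 ≠ 0 := sub_ne_zero.2 (by exact_mod_cast hcard.ne')
  have hq0 : (q : ℚ) ≠ 0 := by positivity
  have hgeom : (∑ i ∈ Finset.range (m + 1), (q : ℚ) ^ i) = (q ^ (m + 1) - 1) / (q - 1) :=
    geom_sum_eq (sub_ne_zero.1 hq1) _
  have h1 : Acount F (m + 1) = 2 + q ^ (m + 1) +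
      (∑ i ∈ Finset.range (m + 1), q ^ (i + (m + 1) - 1)) +
      ∑ i ∈ Finset.range (m + 1), q ^ i := by
    have hsum : (∑ i ∈ Finset.range (m + 1), (q : ℚ) ^ (i + (m + 1) - 1)) =
        (q ^ (m + 1) - 1) / (q - 1) * (q ^ (m + 1) / q) := by
      rw [← hgeom, Finset.sum_mul]
      refine Finset.sum_congr rfl fun i _ => ?_
      rw [← add_assoc, Nat.add_sub_cancel, pow_add, pow_succ, mul_div_cancel_right₀ _ hq0]
    rw [← hsum, ← hgeom] at hA
    exact_mod_cast hA
  have h2 : Bcount F (m + 1) = 3 + (q - 1) * (∑ i ∈ Finset.range (m + 1), q ^ i) ^ 2 +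
      2 * ∑ i ∈ Finset.range (m + 1), q ^ i := by
    rw [← hgeom] at hB
    have : (q : ℚ) - 1 = ((q - 1 : ℕ) : ℚ) := by rw [Nat.cast_sub hcard.le, Nat.cast_one]
    rw [this] at hB
    exact_mod_cast hB
  have h3 : Bcount F (m + 1) =
      Acount F (m + 1) + (q ^ (m + 1) - 1) * (q ^ (m + 1 - 1) - 1) := by
    have : ((Bcount F (m + 1) : ℕ) : ℚ) =
        (Acount F (m + 1) + (q ^ (m + 1) - 1) * (q ^ (m + 1 - 1) - 1) : ℕ) := by
      push_cast [Nat.cast_sub (Nat.one_le_pow _ _ (zero_lt_one.trans hcard))]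
      rw [hA, hB]
      field_simp
      ring
    exact_mod_cast this
  refine ⟨h1, h2, h3, ?_⟩
  have hpos : q ^ (m + 1) - 1 ≠ 0 :=
    (Nat.sub_pos_of_lt (Nat.one_lt_pow m.succ_ne_zero hcard)).ne'
  rw [h3, left_eq_add, mul_eq_zero, or_iff_right hpos, Nat.add_sub_cancel]
  constructor
  · intro h
    by_contra hm
    exact (Nat.sub_pos_of_lt (Nat.one_lt_pow (by lia : m ≠ 0) hcard)).ne' h
  · intro h
    obtain rfl : m = 0 := by lia
    simp
end

section
/- Let q be a prime power, d ≥ 1, n ≥ 2, and R = F_q[t]/(t^d). Let the group (R×)^n act on R^n by (u·a)_i = u_{i+1} a_i u_i^{-1} (indices taken modulo n), and let X = {a ∈ R^n : at most one coordinate a_i is zero}. (X is the set of indecomposable toric representations of the cyclic quiver C_n with n vertices and arrows i → i+1 mod n.) Then the number of orbits of (R×)^n on X equals q^d + Σ_{k=1}^{d−1} [(d−k+1)^n − 2(d−k)^n + (d−k−1)^n]·q^k + [−d^n + (d−1)^n + n·d^{n−1}]. -/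
open Polynomial

/-- The truncated polynomial ring `R = F[t]/(t^d)`. -/
def TruncPoly (F : Type) [Field F] (d : ℕ) : Type :=
  Polynomial F ⧸ Ideal.span {(X : Polynomial F) ^ d}

noncomputable instance (F : Type) [Field F] (d : ℕ) : CommRing (TruncPoly F d) :=
  Ideal.Quotient.commRing _

/-- The number of isomorphism classes of indecomposable toric representations of the cyclic
quiver `C_n` (vertices `ZMod n`, arrows `i → i+1`) over `R = F[t]/(t^d)`: orbits of the
rescaling action `(u·a)_i = u_{i+1} a_i u_i⁻¹` of `(R×)^n` on the set of `a : (ZMod n) → R`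
with at most one vanishing coordinate. -/
noncomputable def cyclicIndecCount (F : Type) [Field F] (d n : ℕ) : ℕ :=
  Nat.card {O : Set {a : ZMod n → TruncPoly F d // ∀ i j, a i = 0 → a j = 0 → i = j} //
    ∃ a₀ : {a : ZMod n → TruncPoly F d // ∀ i j, a i = 0 → a j = 0 → i = j},
      O = {a | ∃ u : ZMod n → (TruncPoly F d)ˣ,
        ∀ i, a.val i = (u (i + 1)).val * a₀.val i * (u i).inv}}

namespace TruncPoly

variable {F : Type} [Field F] {d : ℕ}

/-- The class of the variable in `F[t]/(t^d)`. -/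
noncomputable def var (F : Type) [Field F] (d : ℕ) : TruncPoly F d :=
  Ideal.Quotient.mk (Ideal.span {(X : Polynomial F) ^ d}) X

/-- The projection `F[t] → F[t]/(t^d)`. -/
noncomputable def proj (F : Type) [Field F] (d : ℕ) : Polynomial F →+* TruncPoly F d :=
  Ideal.Quotient.mk (Ideal.span {(X : Polynomial F) ^ d})

theorem proj_surjective : Function.Surjective (proj F d) :=
  Ideal.Quotient.mk_surjective

theorem proj_X : proj F d X = var F d := rfl

theorem proj_eq_zero_iff (p : Polynomial F) : proj F d p = 0 ↔ X ^ d ∣ p := by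
  unfold proj
  exact Ideal.Quotient.eq_zero_iff_dvd _ _

theorem var_pow_eq_zero_iff {m : ℕ} : var F d ^ m = 0 ↔ d ≤ m := by
  rw [← proj_X, ← map_pow, proj_eq_zero_iff]
  exact pow_dvd_pow_iff X_ne_zero not_isUnit_X

theorem var_pow_dvd_proj_iff {k : ℕ} (hk : k ≤ d) (p : Polynomial F) :
    var F d ^ k ∣ proj F d p ↔ X ^ k ∣ p := by
  constructor
  · rintro ⟨y, hy⟩
    obtain ⟨r, rfl⟩ := proj_surjective y
    rw [← proj_X, ← map_pow, ← map_mul, ← sub_eq_zero, ← map_sub, proj_eq_zero_iff] at hy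
    exact (dvd_sub_left (dvd_mul_right _ _)).1 ((pow_dvd_pow X hk).trans hy)
  · rintro ⟨r, rfl⟩
    exact ⟨proj F d r, by rw [map_mul, map_pow, proj_X]⟩

theorem var_pow_mul_eq_zero_iff {m : ℕ} (hm : m ≤ d) (x : TruncPoly F d) :
    var F d ^ m * x = 0 ↔ var F d ^ (d - m) ∣ x := by
  obtain ⟨p, rfl⟩ := proj_surjective x
  rw [var_pow_dvd_proj_iff (Nat.sub_le _ _), ← proj_X, ← map_pow, ← map_mul, proj_eq_zero_iff]
  conv_lhs => rw [← Nat.add_sub_of_le hm, pow_add]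
  exact mul_dvd_mul_iff_left (pow_ne_zero _ X_ne_zero)

theorem isUnit_proj {p : Polynomial F} (hp : ¬ X ∣ p) : IsUnit (proj F d p) := by
  obtain ⟨a, b, h⟩ := (((irreducible_X (R := F)).coprime_iff_not_dvd.2 hp).pow_left (m := d))
  have h' := congrArg (proj F d) h
  rw [map_add, map_mul, map_mul, (proj_eq_zero_iff _).2 dvd_rfl, mul_zero, zero_add, map_one] at h'
  exact IsUnit.of_mul_eq_one_right _ h'

theorem exists_eq_var_pow_mul_unit (x : TruncPoly F d) :
    ∃ (v : ℕ) (w : (TruncPoly F d)ˣ), v ≤ d ∧ x = var F d ^ v * w := by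
  obtain ⟨p, rfl⟩ := proj_surjective x
  by_cases hp : X ^ d ∣ p
  · exact ⟨d, 1, le_rfl, by rw [(proj_eq_zero_iff p).2 hp, var_pow_eq_zero_iff.2 le_rfl, zero_mul]⟩
  · have hp0 : p ≠ 0 := by rintro rfl; exact hp (dvd_zero _)
    obtain ⟨r, hr, hr'⟩ := exists_eq_pow_rootMultiplicity_mul_and_not_dvd p hp0 0
    rw [C_0, sub_zero] at hr hr'
    refine ⟨p.rootMultiplicity 0, (isUnit_proj hr').unit, ?_, ?_⟩
    · by_contra! h
      exact hp (hr ▸ (pow_dvd_pow X h.le).mul_right r)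
    · rw [IsUnit.unit_spec, ← proj_X, ← map_pow, ← map_mul, ← hr]

theorem eq_of_var_pow_mul_unit_eq {v v' : ℕ} {w w' : (TruncPoly F d)ˣ} (hv : v ≤ d) (hv' : v' ≤ d)
    (h : var F d ^ v * (w : TruncPoly F d) = var F d ^ v' * w') : v = v' := by
  wlog hlt : v' ≤ v generalizing v v' w w'
  · exact (this hv' hv h.symm (le_of_not_ge hlt)).symm
  refine le_antisymm ?_ hlt
  have h0 : var F d ^ (d - v) * (var F d ^ v' * (w' : TruncPoly F d)) = 0 := by
    rw [← h, ← mul_assoc, ← pow_add, var_pow_eq_zero_iff.2 (by omega), zero_mul]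
  rw [← mul_assoc, Units.mul_left_eq_zero, ← pow_add, var_pow_eq_zero_iff] at h0
  omega

/-- The group of units congruent to `1` modulo `t^k`. -/
def higherUnits (F : Type) [Field F] (d k : ℕ) : Subgroup (TruncPoly F d)ˣ where
  carrier := {u | var F d ^ k ∣ (u : TruncPoly F d) - 1}
  one_mem' := by simp
  mul_mem' {a b} ha hb := by
    have : ((a * b : (TruncPoly F d)ˣ) : TruncPoly F d) - 1 = (a - 1) * b + (b - 1) := by
      push_cast; ring
    simp only [Set.mem_ofPred_eq] at *
    rw [this]
    exact dvd_add (ha.mul_right _) hb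
  inv_mem' {a} ha := by
    have : ((a⁻¹ : (TruncPoly F d)ˣ) : TruncPoly F d) - 1 = (a - 1) * -(a⁻¹ : (TruncPoly F d)ˣ) := by
      rw [mul_neg, sub_mul, Units.mul_inv]; ring
    simp only [Set.mem_ofPred_eq] at *
    rw [this]
    exact ha.mul_right _

theorem mem_higherUnits {k : ℕ} {u : (TruncPoly F d)ˣ} :
    u ∈ higherUnits F d k ↔ var F d ^ k ∣ (u : TruncPoly F d) - 1 := Iff.rfl

theorem higherUnits_anti {k l : ℕ} (h : k ≤ l) : higherUnits F d l ≤ higherUnits F d k :=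
  fun _ hu => (pow_dvd_pow _ h).trans hu

theorem var_pow_mul_eq_iff {m : ℕ} (hm : m ≤ d) (w w' : (TruncPoly F d)ˣ) :
    var F d ^ m * (w : TruncPoly F d) = var F d ^ m * w' ↔ w / w' ∈ higherUnits F d (d - m) := by
  rw [mem_higherUnits, ← var_pow_mul_eq_zero_iff hm, ← Units.mul_left_eq_zero w', mul_assoc,
    sub_mul, ← Units.val_mul, div_mul_cancel, one_mul, mul_sub, sub_eq_zero]

theorem card_truncPoly [Fintype F] : Nat.card (TruncPoly F d) = Fintype.card F ^ d := by
  have hm : (X ^ d : Polynomial F).Monic := monic_X_pow d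
  have e := Nat.card_congr (AdjoinRoot.powerBasis' hm).basis.equivFun.toEquiv
  rwa [Nat.card_fun, Nat.card_eq_fintype_card (α := F), Nat.card_fin, AdjoinRoot.powerBasis'_dim,
    natDegree_X_pow] at e

instance [Finite F] : Finite (TruncPoly F d) := by
  have := Fintype.ofFinite F
  exact Nat.finite_of_card_ne_zero (by rw [card_truncPoly]; positivity)

theorem card_dvd_var_pow [Fintype F] {k : ℕ} (hk : k ≤ d) :
    Nat.card {x : TruncPoly F d // var F d ^ k ∣ x} = Fintype.card F ^ (d - k) := by
  have hle : Ideal.span {(X : Polynomial F) ^ d} ≤ Ideal.span {X ^ k} :=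
    Ideal.span_singleton_le_span_singleton.2 (pow_dvd_pow X hk)
  let φ : TruncPoly F d →+* TruncPoly F k := Ideal.Quotient.factor hle
  have hφ : ∀ p, φ (proj F d p) = proj F k p := fun p => Ideal.Quotient.factor_mk hle p
  have hker : ∀ x, x ∈ φ.toAddMonoidHom.ker ↔ var F d ^ k ∣ x := by
    intro x
    obtain ⟨p, rfl⟩ := proj_surjective x
    rw [var_pow_dvd_proj_iff hk, ← proj_eq_zero_iff, ← hφ]
    rfl
  have hsurj : Function.Surjective φ.toAddMonoidHom := by
    intro y
    obtain ⟨p, rfl⟩ := proj_surjective y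
    exact ⟨proj F d p, hφ p⟩
  have h := φ.toAddMonoidHom.ker.card_mul_index
  rw [AddSubgroup.index_ker, AddMonoidHom.range_eq_top.2 hsurj, AddSubgroup.card_top,
    card_truncPoly, card_truncPoly] at h
  rw [← Nat.card_congr (Equiv.subtypeEquivRight hker)]
  have hq : 0 < Fintype.card F ^ k := by positivity
  refine Nat.eq_of_mul_eq_mul_right hq ?_
  rw [← pow_add, Nat.sub_add_cancel hk]
  exact h

theorem isUnit_iff_not_var_dvd (hd : 1 ≤ d) (x : TruncPoly F d) : IsUnit x ↔ ¬ var F d ∣ x := by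
  constructor
  · intro hx h
    have h1 := isUnit_of_dvd_unit h hx
    have h2 : (var F d) ^ d = 0 := var_pow_eq_zero_iff.2 le_rfl
    have h3 : IsUnit (0 : TruncPoly F d) := h2 ▸ h1.pow d
    have h4 : var F d ^ 0 = 0 := by
      rw [pow_zero]; exact (isUnit_zero_iff.1 h3).symm
    rw [var_pow_eq_zero_iff] at h4
    omega
  · intro h
    obtain ⟨v, w, -, rfl⟩ := exists_eq_var_pow_mul_unit x
    rcases v with _ | v
    · simp
    · exact absurd (((dvd_pow_self _ v.succ_ne_zero)).mul_right _) h

theorem card_units [Fintype F] (hd : 1 ≤ d) :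
    Nat.card (TruncPoly F d)ˣ + Fintype.card F ^ (d - 1) = Fintype.card F ^ d := by
  classical
  have e : (TruncPoly F d)ˣ ≃ {x : TruncPoly F d // ¬ var F d ∣ x} :=
    (Equiv.ofBijective (fun u => (⟨u.1, (isUnit_iff_not_var_dvd hd _).1 u.isUnit⟩ :
      {x : TruncPoly F d // ¬ var F d ∣ x}))
      ⟨fun u v h => Units.ext (congrArg Subtype.val h), fun x =>
        ⟨((isUnit_iff_not_var_dvd hd _).2 x.2).unit, rfl⟩⟩)
  have h := card_dvd_var_pow (F := F) hd
  rw [pow_one] at h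
  rw [← h, Nat.card_congr e, ← card_truncPoly (F := F) (d := d), add_comm,
    ← Nat.card_sum]
  exact Nat.card_congr (Equiv.sumCompl _)

theorem card_higherUnits [Fintype F] {k : ℕ} (hk : 1 ≤ k) (hkd : k ≤ d) :
    Nat.card (higherUnits F d k) = Fintype.card F ^ (d - k) := by
  rw [← card_dvd_var_pow hkd]
  refine Nat.card_congr (Equiv.ofBijective (fun u => ⟨(u.1 : TruncPoly F d) - 1, u.2⟩) ⟨?_, ?_⟩)
  · intro u v h
    exact Subtype.ext (Units.ext (sub_left_injective (congrArg Subtype.val h)))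
  · rintro ⟨x, hx⟩
    have hu : IsUnit (x + 1) := by
      refine IsNilpotent.isUnit_add_one ⟨d, ?_⟩
      obtain ⟨y, rfl⟩ := hx
      rw [mul_pow, ← pow_mul, var_pow_eq_zero_iff.2 (by nlinarith), zero_mul]
    refine ⟨⟨hu.unit, ?_⟩, ?_⟩
    · rw [mem_higherUnits]; simpa using hx
    · simp

theorem card_quotient_higherUnits [Fintype F] {k : ℕ} (hk : 1 ≤ k) (hkd : k ≤ d) :
    (Nat.card ((TruncPoly F d)ˣ ⧸ higherUnits F d k) : ℤ) =
      (Fintype.card F : ℤ) ^ k - (Fintype.card F : ℤ) ^ (k - 1) := by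
  have h := (higherUnits F d k).card_eq_card_quotient_mul_card_subgroup
  have h' := card_units (F := F) (hk.trans hkd)
  rw [h, card_higherUnits hk hkd] at h'
  have hq : (Fintype.card F : ℤ) ^ (d - k) ≠ 0 := by positivity
  refine mul_right_cancel₀ hq ?_
  rw [sub_mul, ← pow_add, ← pow_add, Nat.add_sub_of_le hkd, show k - 1 + (d - k) = d - 1 by omega]
  zify at h'
  linarith

theorem card_quotient_higherUnits_zero :
    Nat.card ((TruncPoly F d)ˣ ⧸ higherUnits F d 0) = 1 := by
  have : higherUnits F d 0 = ⊤ := by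
    ext u; simp [mem_higherUnits]
  exact Subgroup.index_eq_one.2 this

end TruncPoly

theorem card_setOf_fibers {α T : Type*} (orb : α → Set α) (f : α → T)
    (hf : Function.Surjective f) (h : ∀ a b, b ∈ orb a ↔ f b = f a) :
    Nat.card {O : Set α // ∃ a, O = orb a} = Nat.card T := by
  refine (Nat.card_congr (Equiv.ofBijective
    (fun t => (⟨orb (Function.surjInv hf t), _, rfl⟩ : {O : Set α // ∃ a, O = orb a}))
    ⟨?_, ?_⟩)).symm
  · intro s t hst
    have h1 : orb (Function.surjInv hf s) = orb (Function.surjInv hf t) := congrArg Subtype.val hst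
    have h2 := (h (Function.surjInv hf t) (Function.surjInv hf s)).1 (h1 ▸ (h _ _).2 rfl)
    rwa [Function.surjInv_eq hf, Function.surjInv_eq hf] at h2
  · rintro ⟨_, a, rfl⟩
    refine ⟨f a, Subtype.ext (Set.ext fun b => ?_)⟩
    change b ∈ orb (Function.surjInv hf (f a)) ↔ b ∈ orb a
    rw [h, h, Function.surjInv_eq hf]

theorem ZMod.exists_div_eq_of_prod_eq_one {G : Type*} [CommGroup G] {n : ℕ} [NeZero n]
    (hn : 2 ≤ n) (r : ZMod n → G) (hr : ∏ i, r i = 1) :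
    ∃ u : ZMod n → G, ∀ i, u (i + 1) / u i = r i := by
  obtain ⟨n, rfl⟩ : ∃ m, n = m + 1 := ⟨n - 1, by omega⟩
  have hr' : ∏ k ∈ Finset.range (n + 1), r (k : ZMod (n + 1)) = 1 := by
    rw [← hr, Finset.prod_range]
    exact Finset.prod_congr rfl fun i _ => congrArg r (ZMod.natCast_zmod_val (n := n + 1) i)
  refine ⟨fun i => ∏ k ∈ Finset.range i.val, r (k : ZMod (n + 1)), fun i => ?_⟩
  have hi : r ((i.val : ℕ) : ZMod (n + 1)) = r i := by rw [ZMod.natCast_zmod_val]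
  have : Fact (1 < n + 1) := ⟨by omega⟩
  beta_reduce
  by_cases hlt : i.val + 1 < n + 1
  · rw [ZMod.val_add_of_lt (by rwa [ZMod.val_one]), ZMod.val_one, Finset.prod_range_succ, hi,
      mul_div_cancel_left]
  · have hv : i.val = n := by have := ZMod.val_lt i; omega
    have h0 : i + 1 = 0 := by
      rw [← ZMod.natCast_zmod_val i, hv, ← Nat.cast_succ, ZMod.natCast_self]
    rw [Finset.prod_range_succ, show r (n : ZMod (n + 1)) = r i by rw [← hi, hv]] at hr'
    rw [h0, ZMod.val_zero, Finset.prod_range_zero, one_div, hv]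
    exact inv_eq_of_mul_eq_one_right hr'

/-- Functions `ι → {0, …, d}` taking the value `d` at most once. -/
def atMostOneTop (ι : Type*) [Fintype ι] [DecidableEq ι] (d : ℕ) : Finset (ι → ℕ) :=
  (Fintype.piFinset fun _ => Finset.range (d + 1)).filter
    fun v => ∀ i j, v i = d → v j = d → i = j

section Counting

variable {ι : Type*} [Fintype ι] [DecidableEq ι] {d : ℕ}

theorem mem_atMostOneTop {v : ι → ℕ} :
    v ∈ atMostOneTop ι d ↔ (∀ i, v i ≤ d) ∧ ∀ i j, v i = d → v j = d → i = j := by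
  simp [atMostOneTop]

theorem card_atMostOneTop_sup_lt [Nonempty ι] {m : ℕ} (hm : m < d) :
    (((atMostOneTop ι d).filter fun v => Finset.univ.sup v = m).card : ℤ) =
      ((m : ℤ) + 1) ^ Fintype.card ι - (m : ℤ) ^ Fintype.card ι := by
  have hsub : (Fintype.piFinset fun _ : ι => Finset.range m) ⊆
      Fintype.piFinset fun _ : ι => Finset.range (m + 1) :=
    Fintype.piFinset_subset _ _ fun _ => Finset.range_mono m.le_succ
  have heq : (atMostOneTop ι d).filter (fun v => Finset.univ.sup v = m) =
      (Fintype.piFinset fun _ : ι => Finset.range (m + 1)) \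
        Fintype.piFinset fun _ : ι => Finset.range m := by
    ext v
    simp only [Finset.mem_filter, mem_atMostOneTop, Finset.mem_sdiff, Fintype.mem_piFinset,
      Finset.mem_range, Nat.lt_succ_iff]
    constructor
    · rintro ⟨-, rfl⟩
      refine ⟨fun i => Finset.le_sup (Finset.mem_univ i), fun h => ?_⟩
      obtain ⟨j, -, hj⟩ := Finset.exists_mem_eq_sup Finset.univ Finset.univ_nonempty v
      exact (h j).ne hj.symm
    · rintro ⟨h1, h2⟩
      push Not at h2
      obtain ⟨j, hj⟩ := h2
      refine ⟨⟨fun i => (h1 i).trans hm.le, fun i _ hi => absurd hi ((h1 i).trans_lt hm).ne⟩, ?_⟩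
      exact le_antisymm (Finset.sup_le fun i _ => h1 i)
        (hj.trans (Finset.le_sup (Finset.mem_univ j)))
  rw [heq, Finset.cast_card_sdiff hsub]
  simp

theorem card_atMostOneTop_sup_eq [Nonempty ι] :
    ((atMostOneTop ι d).filter fun v => Finset.univ.sup v = d).card =
      Fintype.card ι * d ^ (Fintype.card ι - 1) := by
  have heq : (atMostOneTop ι d).filter (fun v => Finset.univ.sup v = d) =
      Finset.univ.biUnion fun j : ι =>
        Fintype.piFinset fun i => if i = j then {d} else Finset.range d := by
    ext v
    simp only [Finset.mem_filter, mem_atMostOneTop, Finset.mem_biUnion, Fintype.mem_piFinset,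
      Finset.mem_univ, true_and]
    constructor
    · rintro ⟨⟨h1, h2⟩, h3⟩
      obtain ⟨j, -, hj⟩ := Finset.exists_mem_eq_sup Finset.univ Finset.univ_nonempty v
      refine ⟨j, fun i => ?_⟩
      split_ifs with hij
      · rw [Finset.mem_singleton, hij, ← hj, h3]
      · rw [Finset.mem_range]
        exact (h1 i).lt_of_ne fun hi => hij (h2 i j hi (hj.symm.trans h3))
    · rintro ⟨j, hj⟩
      have hjj : v j = d := by simpa using hj j
      have hne : ∀ i, i ≠ j → v i < d := fun i hi => by simpa [hi] using hj i
      have hle : ∀ i, v i ≤ d := fun i => by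
        by_cases hi : i = j
        · exact (hi ▸ hjj).le
        · exact (hne i hi).le
      have huniq : ∀ i, v i = d → i = j := fun i hi => by
        by_contra h
        exact (hne i h).ne hi
      refine ⟨⟨hle, fun i k hi hk => (huniq i hi).trans (huniq k hk).symm⟩, ?_⟩
      exact le_antisymm (Finset.sup_le fun i _ => hle i) (hjj ▸ Finset.le_sup (Finset.mem_univ j))
  rw [heq, Finset.card_biUnion]
  · have : ∀ j : ι, (Fintype.piFinset fun i => if i = j then {d} else Finset.range d).card =
        d ^ (Fintype.card ι - 1) := by
      intro j
      rw [Fintype.card_piFinset, ← Finset.mul_prod_erase _ _ (Finset.mem_univ j), if_pos rfl,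
        Finset.card_singleton, one_mul, Finset.prod_congr rfl
          (fun i hi => by rw [if_neg (Finset.ne_of_mem_erase hi), Finset.card_range]),
        Finset.prod_const, Finset.card_erase_of_mem (Finset.mem_univ j), Finset.card_univ]
    simp [this]
  · intro j _ k _ hjk
    rw [Function.onFun, Finset.disjoint_left]
    intro v hv hv'
    have h1 : v j = d := by simpa using Fintype.mem_piFinset.1 hv j
    have h2 : v j < d := by simpa [hjk] using Fintype.mem_piFinset.1 hv' j
    omega

theorem sum_atMostOneTop [Nonempty ι] (c : ℕ → ℤ) :
    ∑ v ∈ atMostOneTop ι d, c (Finset.univ.sup v) =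
      (∑ m ∈ Finset.range d,
        (((m : ℤ) + 1) ^ Fintype.card ι - (m : ℤ) ^ Fintype.card ι) * c m) +
      (Fintype.card ι : ℤ) * (d : ℤ) ^ (Fintype.card ι - 1) * c d := by
  have hmaps : ∀ v ∈ atMostOneTop ι d, Finset.univ.sup v ∈ Finset.range (d + 1) := fun v hv =>
    Finset.mem_range_succ_iff.2 (Finset.sup_le fun i _ => (mem_atMostOneTop.1 hv).1 i)
  have hfiber : ∀ m, ∑ v ∈ atMostOneTop ι d with Finset.univ.sup v = m, c (Finset.univ.sup v) =
      ((atMostOneTop ι d).filter fun v => Finset.univ.sup v = m).card * c m := fun m => by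
    rw [Finset.sum_congr rfl fun v hv => by rw [(Finset.mem_filter.1 hv).2], Finset.sum_const,
      nsmul_eq_mul]
  rw [← Finset.sum_fiberwise_of_maps_to hmaps, Finset.sum_range_succ, hfiber,
    card_atMostOneTop_sup_eq, Nat.cast_mul, Nat.cast_pow]
  congr 1
  exact Finset.sum_congr rfl fun m hm => by
    rw [hfiber, card_atMostOneTop_sup_lt (Finset.mem_range.1 hm)]

end Counting

theorem sum_diff_mul_diff_pow {n e : ℕ} (hn : n ≠ 0) (q : ℤ) :
    ∑ m ∈ Finset.range (e + 1),
      (((m : ℤ) + 1) ^ n - (m : ℤ) ^ n) * (q ^ (e + 1 - m) - q ^ (e + 1 - m - 1)) =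
    q ^ (e + 1) + (∑ k ∈ Finset.Icc 1 e,
      (((e : ℤ) + 1 - k + 1) ^ n - 2 * ((e : ℤ) + 1 - k) ^ n + ((e : ℤ) + 1 - k - 1) ^ n) * q ^ k) +
    (-((e : ℤ) + 1) ^ n + (e : ℤ) ^ n) := by
  let g : ℕ → ℤ := fun k => ((e : ℤ) + 1 - k) ^ n - ((e : ℤ) - k) ^ n
  have hL : ∑ m ∈ Finset.range (e + 1),
      (((m : ℤ) + 1) ^ n - (m : ℤ) ^ n) * (q ^ (e + 1 - m) - q ^ (e + 1 - m - 1)) =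
      ∑ k ∈ Finset.range (e + 1), g k * q ^ (k + 1) - ∑ k ∈ Finset.range (e + 1), g k * q ^ k := by
    rw [← Finset.sum_range_reflect, ← Finset.sum_sub_distrib]
    refine Finset.sum_congr rfl fun k hk => ?_
    have hk' : k ≤ e := Nat.lt_succ_iff.1 (Finset.mem_range.1 hk)
    rw [show e + 1 - 1 - k = e - k by omega, show e + 1 - (e - k) = k + 1 by omega,
      Nat.add_sub_cancel, Nat.cast_sub hk', ← mul_sub]
    congr 2
    ring
  have hR : ∑ k ∈ Finset.Icc 1 e,
      (((e : ℤ) + 1 - k + 1) ^ n - 2 * ((e : ℤ) + 1 - k) ^ n + ((e : ℤ) + 1 - k - 1) ^ n) * q ^ k =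
      ∑ k ∈ Finset.range e, (g k - g (k + 1)) * q ^ (k + 1) := by
    rw [← Finset.Ico_succ_right_eq_Icc, Finset.sum_Ico_eq_sum_range]
    refine Finset.sum_congr (by simp) fun k _ => ?_
    simp only [g]
    push_cast
    rw [add_comm 1 k]
    ring_nf
  rw [hL, hR, Finset.sum_range_succ, Finset.sum_range_succ' (fun k => g k * q ^ k)]
  simp only [sub_mul, Finset.sum_sub_distrib, g]
  simp only [Nat.cast_zero, Nat.cast_add, Nat.cast_one, sub_zero, sub_self, add_sub_cancel_left, one_pow, zero_pow hn, pow_zero]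
  ring

theorem Sigma.mk_quotient_eq_iff {ι G : Type*} [Group G] (K : ι → Subgroup G) {v v' : ι}
    {x x' : G} :
    (⟨v, (x : G ⧸ K v)⟩ : Σ v, G ⧸ K v) = ⟨v', (x' : G ⧸ K v')⟩ ↔ v = v' ∧ x⁻¹ * x' ∈ K v := by
  constructor
  · intro h
    obtain rfl : v = v' := congrArg Sigma.fst h
    exact ⟨rfl, QuotientGroup.eq.1 (eq_of_heq (Sigma.mk.inj h).2)⟩
  · rintro ⟨rfl, h⟩
    rw [QuotientGroup.eq.2 h]

namespace TruncPoly

variable {F : Type} [Field F] {d n : ℕ}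

/-- The `t`-adic order of an element of `F[t]/(t^d)`, with `ord 0 = d`. -/
noncomputable def ord (x : TruncPoly F d) : ℕ := (exists_eq_var_pow_mul_unit x).choose

/-- A unit `w` with `x = t ^ ord x * w`. -/
noncomputable def unitPart (x : TruncPoly F d) : (TruncPoly F d)ˣ :=
  (exists_eq_var_pow_mul_unit x).choose_spec.choose

theorem ord_le (x : TruncPoly F d) : ord x ≤ d :=
  (exists_eq_var_pow_mul_unit x).choose_spec.choose_spec.1

theorem eq_var_pow_ord_mul_unitPart (x : TruncPoly F d) : x = var F d ^ ord x * unitPart x :=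
  (exists_eq_var_pow_mul_unit x).choose_spec.choose_spec.2

theorem var_pow_mul_unit_eq_zero_iff {v : ℕ} (w : (TruncPoly F d)ˣ) :
    var F d ^ v * (w : TruncPoly F d) = 0 ↔ d ≤ v := by
  rw [Units.mul_left_eq_zero, var_pow_eq_zero_iff]

theorem eq_zero_of_ord_eq {x : TruncPoly F d} (h : ord x = d) : x = 0 := by
  rw [eq_var_pow_ord_mul_unitPart x, var_pow_mul_unit_eq_zero_iff, h]

/-- Tuples indexed by `ZMod n` with at most one vanishing coordinate. -/
abbrev IndecTuple (F : Type) [Field F] (d n : ℕ) : Type :=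
  {a : ZMod n → TruncPoly F d // ∀ i j, a i = 0 → a j = 0 → i = j}

variable [NeZero n]

/-- The values of the complete invariant `invariant` of the rescaling action. -/
abbrev InvariantType (F : Type) [Field F] (d n : ℕ) [NeZero n] : Type :=
  Σ v : atMostOneTop (ZMod n) d, (TruncPoly F d)ˣ ⧸ higherUnits F d (d - Finset.univ.sup v.1)

/-- The orders of the coordinates, together with the product of their unit parts modulo
`t ^ (d - m)`, where `m` is the largest order. -/
noncomputable def invariant (a : IndecTuple F d n) : InvariantType F d n :=
  ⟨⟨fun i => ord (a.1 i), mem_atMostOneTop.2 ⟨fun _ => ord_le _, fun i j hi hj =>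
    a.2 i j (eq_zero_of_ord_eq hi) (eq_zero_of_ord_eq hj)⟩⟩,
    ((∏ i, unitPart (a.1 i) : (TruncPoly F d)ˣ) : _ ⧸ _)⟩

theorem invariant_eq_mk (a : IndecTuple F d n) (v : atMostOneTop (ZMod n) d)
    (w : ZMod n → (TruncPoly F d)ˣ) (h : ∀ i, a.1 i = var F d ^ v.1 i * (w i : TruncPoly F d)) :
    invariant a = ⟨v, ((∏ i, w i : (TruncPoly F d)ˣ) : _ ⧸ _)⟩ := by
  have hord : ∀ i, ord (a.1 i) = v.1 i := fun i =>
    eq_of_var_pow_mul_unit_eq (ord_le _) ((mem_atMostOneTop.1 v.2).1 i)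
      ((eq_var_pow_ord_mul_unitPart _).symm.trans (h i))
  refine (Sigma.mk_quotient_eq_iff
    (fun v : atMostOneTop (ZMod n) d => higherUnits F d (d - Finset.univ.sup v.1))).2
    ⟨Subtype.ext (funext hord), ?_⟩
  rw [inv_mul_eq_div, ← Finset.prod_div_distrib]
  refine Subgroup.prod_mem _ fun i _ => ?_
  refine higherUnits_anti (Nat.sub_le_sub_left
    (Finset.le_sup (f := fun i => ord (a.1 i)) (Finset.mem_univ i)) d) ?_
  rw [← var_pow_mul_eq_iff (ord_le _), ← eq_var_pow_ord_mul_unitPart, hord, h]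

theorem invariant_surjective : Function.Surjective (invariant : IndecTuple F d n → _) := by
  rintro ⟨v, c⟩
  obtain ⟨w, rfl⟩ := QuotientGroup.mk_surjective c
  have hv := mem_atMostOneTop.1 v.2
  have hzero : ∀ i, var F d ^ v.1 i * ((Pi.mulSingle 0 w : ZMod n → (TruncPoly F d)ˣ) i :
      TruncPoly F d) = 0 → v.1 i = d := fun i hi =>
    (hv.1 i).antisymm ((var_pow_mul_unit_eq_zero_iff _).1 hi)
  refine ⟨⟨_, fun i j hi hj => hv.2 i j (hzero i hi) (hzero j hj)⟩, ?_⟩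
  rw [invariant_eq_mk _ v (Pi.mulSingle 0 w) fun i => rfl, Finset.prod_pi_mulSingle']
  simp

theorem exists_rescaling_iff_invariant_eq (hn : 2 ≤ n) (a b : IndecTuple F d n) :
    (∃ u : ZMod n → (TruncPoly F d)ˣ, ∀ i, b.1 i = (u (i + 1)).val * a.1 i * (u i).inv) ↔
      invariant b = invariant a := by
  constructor
  · rintro ⟨u, hu⟩
    rw [invariant_eq_mk b (invariant a).1 (fun i => u (i + 1) * unitPart (a.1 i) * (u i)⁻¹)]
    · have hprod : ∏ i, (u (i + 1) * unitPart (a.1 i) * (u i)⁻¹) = ∏ i, unitPart (a.1 i) := by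
        rw [Finset.prod_mul_distrib, Finset.prod_mul_distrib, Finset.prod_inv_distrib,
          show ∏ i, u (i + 1) = ∏ i, u i from Equiv.prod_comp (Equiv.addRight (1 : ZMod n)) u,
          mul_inv_cancel_comm]
      rw [hprod]
      rfl
    · intro i
      rw [hu i]
      conv_lhs => rw [eq_var_pow_ord_mul_unitPart (a.1 i)]
      simp only [Units.inv_eq_val_inv, Units.val_mul, invariant]
      ring
  · intro h
    obtain ⟨hv, hw⟩ := (Sigma.mk_quotient_eq_iff
      (fun v : atMostOneTop (ZMod n) d => higherUnits F d (d - Finset.univ.sup v.1))).1 h.symm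
    have hord : ∀ i, ord (a.1 i) = ord (b.1 i) := congrFun (congrArg Subtype.val hv)
    set ρ := (∏ i, unitPart (a.1 i))⁻¹ * ∏ i, unitPart (b.1 i) with hρ
    obtain ⟨j, -, hj⟩ := Finset.exists_mem_eq_sup Finset.univ Finset.univ_nonempty
      fun i => ord (a.1 i)
    let s : ZMod n → (TruncPoly F d)ˣ := Pi.mulSingle j ρ
    have hs : ∀ i, s i ∈ higherUnits F d (d - ord (b.1 i)) := by
      intro i
      by_cases hi : i = j
      · subst hi
        rw [← hord, ← hj]
        simpa [s] using hw
      · simp [s, hi, one_mem]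
    obtain ⟨u, hu⟩ := ZMod.exists_div_eq_of_prod_eq_one hn
      (fun i => unitPart (b.1 i) / unitPart (a.1 i) / s i) (by
        rw [Finset.prod_div_distrib, Finset.prod_div_distrib, Finset.prod_pi_mulSingle',
          if_pos (Finset.mem_univ j), hρ, inv_mul_eq_div, div_self'])
    refine ⟨u, fun i => ?_⟩
    have hb : b.1 i = var F d ^ ord (b.1 i) * ((unitPart (b.1 i) / s i : (TruncPoly F d)ˣ) :
        TruncPoly F d) := by
      conv_lhs => rw [eq_var_pow_ord_mul_unitPart (b.1 i)]
      rw [var_pow_mul_eq_iff (ord_le _), div_div_cancel]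
      exact hs i
    have hunit : unitPart (b.1 i) / s i = u (i + 1) * unitPart (a.1 i) * (u i)⁻¹ := by
      rw [mul_right_comm, ← div_eq_mul_inv, hu, div_right_comm, div_mul_cancel]
    rw [hb, hunit, ← hord]
    conv_rhs => rw [eq_var_pow_ord_mul_unitPart (a.1 i)]
    simp only [Units.inv_eq_val_inv, Units.val_mul]
    ring

theorem card_invariantType [Fintype F] : (Nat.card (InvariantType F d n) : ℤ) =
    (∑ m ∈ Finset.range d, (((m : ℤ) + 1) ^ n - (m : ℤ) ^ n) *
      ((Fintype.card F : ℤ) ^ (d - m) - (Fintype.card F : ℤ) ^ (d - m - 1))) +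
      (n : ℤ) * (d : ℤ) ^ (n - 1) := by
  have h := sum_atMostOneTop (ι := ZMod n) (d := d)
    fun m => (Nat.card ((TruncPoly F d)ˣ ⧸ higherUnits F d (d - m)) : ℤ)
  rw [Nat.card_sigma, Nat.cast_sum,
    Finset.sum_coe_sort (atMostOneTop (ZMod n) d)
      fun v => (Nat.card ((TruncPoly F d)ˣ ⧸ higherUnits F d (d - Finset.univ.sup v)) : ℤ), h,
    ZMod.card, Nat.sub_self, card_quotient_higherUnits_zero, Nat.cast_one, mul_one]
  congr 1
  refine Finset.sum_congr rfl fun m hm => ?_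
  have := Finset.mem_range.1 hm
  rw [card_quotient_higherUnits (by omega) (by omega)]

end TruncPoly

/-- The count of absolutely indecomposable toric representations of the cyclic quiver `C_n`
over `F_q[t]/(t^d)`:
`A_d(C_n, q) = q^d + Σ_{k=1}^{d-1} [(d-k+1)^n − 2(d-k)^n + (d-k-1)^n] q^k
  + [−d^n + (d−1)^n + n d^{n−1}]`. -/
theorem cyclic_quiver_indecomposable_count
    (F : Type) [Field F] [Fintype F] (d n : ℕ) (hd : 1 ≤ d) (hn : 2 ≤ n) :
    (cyclicIndecCount F d n : ℤ) =
      (Fintype.card F : ℤ) ^ d +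
      (∑ k ∈ Finset.Icc 1 (d - 1),
        (((d : ℤ) - k + 1) ^ n - 2 * ((d : ℤ) - k) ^ n + ((d : ℤ) - k - 1) ^ n) *
          (Fintype.card F : ℤ) ^ k) +
      (-(d : ℤ) ^ n + ((d : ℤ) - 1) ^ n + (n : ℤ) * (d : ℤ) ^ (n - 1)) := by
  have : NeZero n := ⟨by omega⟩
  obtain ⟨e, rfl⟩ : ∃ e, d = e + 1 := ⟨d - 1, by omega⟩
  rw [show cyclicIndecCount F (e + 1) n = Nat.card (TruncPoly.InvariantType F (e + 1) n) from
    card_setOf_fibers _ TruncPoly.invariant TruncPoly.invariant_surjective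
      (TruncPoly.exists_rescaling_iff_invariant_eq hn),
    TruncPoly.card_invariantType, sum_diff_mul_diff_pow (by omega)]
  push_cast
  rw [add_sub_cancel_right]
  ring
end
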